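/- Let n ≥ 39 and let μ be a Young diagram with n boxes that has at least 14 boxes outside its first row and at least 14 boxes outside its first column. Then the number of standard Young tableaux of shape μ is at least n^{6.05}. (Equivalently, every irreducible representation of S_n whose Young diagram has at least 14 blocks outside the first row and at least 14 blocks outside the first column has dimension at least n^{6.05}.) -/

import Mathlib

/-- A standard Young tableau of shape `μ` (with `μ.card` boxes), encoded as a bijection
from the cells of `μ` to `Fin μ.card`, strictly increasing along each row (left to right)
and along each column (top to bottom). Cells are pairs `(i, j)` with `i` the row index
and `j` the column index. -/
def IsStandardYT (μ : YoungDiagram) (T : {x // x ∈ μ.cells} ≃ Fin μ.card) : Prop :=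
  (∀ a b : {x // x ∈ μ.cells}, a.1.1 = b.1.1 → a.1.2 < b.1.2 → T a < T b) ∧
  (∀ a b : {x // x ∈ μ.cells}, a.1.2 = b.1.2 → a.1.1 < b.1.1 → T a < T b)

namespace YoungDiagram

/-- The cells of `μ` whose removal leaves a Young diagram. -/
def corners (μ : YoungDiagram) : Finset (ℕ × ℕ) :=
  μ.cells.filter fun x => (x.1 + 1, x.2) ∉ μ ∧ (x.1, x.2 + 1) ∉ μ

/-- The diagram of the cells of `μ` that are not weakly below and to the right of `x`;
if `x` is a corner, this removes `x` alone. -/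
def remove (μ : YoungDiagram) (x : ℕ × ℕ) : YoungDiagram where
  cells := μ.cells.filter fun y => ¬ x ≤ y
  isLowerSet := by
    intro a b hba ha
    simp only [Finset.coe_filter, Set.mem_ofPred_eq] at ha ⊢
    exact ⟨μ.isLowerSet hba ha.1, fun h => ha.2 (h.trans hba)⟩

theorem injective_shift : Function.Injective fun x : ℕ × ℕ => (x.1 + 1, x.2) := by
  intro x y h
  simpa [Prod.ext_iff] using h

/-- The diagram obtained from `μ` by deleting its first row. -/
noncomputable def tail (μ : YoungDiagram) : YoungDiagram where
  cells := μ.cells.preimage (fun x => (x.1 + 1, x.2)) injective_shift.injOn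
  isLowerSet := by
    rintro ⟨a, b⟩ ⟨c, d⟩ hba ha
    rw [Finset.mem_coe, Finset.mem_preimage] at ha ⊢
    exact μ.up_left_mem (Nat.succ_le_succ hba.1) hba.2 ha

variable {μ : YoungDiagram} {x y : ℕ × ℕ}

theorem mem_corners :
    x ∈ μ.corners ↔ x ∈ μ ∧ (x.1 + 1, x.2) ∉ μ ∧ (x.1, x.2 + 1) ∉ μ := by
  simp [corners]

theorem mem_remove : y ∈ μ.remove x ↔ y ∈ μ ∧ ¬ x ≤ y := by
  rw [← mem_cells]
  simp [remove]

theorem mem_tail {i j : ℕ} : (i, j) ∈ μ.tail ↔ (i + 1, j) ∈ μ := by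
  rw [← mem_cells]
  simp [tail]

theorem eq_of_mem_corners_of_le (hx : x ∈ μ.corners) (hy : y ∈ μ) (h : x ≤ y) : y = x := by
  obtain ⟨a, b⟩ := x
  obtain ⟨c, d⟩ := y
  obtain ⟨-, h1, h2⟩ := mem_corners.1 hx
  obtain ⟨hac, hbd⟩ := Prod.mk_le_mk.1 h
  rcases hac.lt_or_eq with hac' | rfl
  · exact absurd (μ.up_left_mem hac' hbd hy) h1
  rcases hbd.lt_or_eq with hbd' | rfl
  · exact absurd (μ.up_left_mem le_rfl hbd' hy) h2
  rfl

theorem mem_remove_iff_ne (hx : x ∈ μ.corners) : y ∈ μ.remove x ↔ y ∈ μ ∧ y ≠ x := by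
  rw [mem_remove]
  refine and_congr_right fun hy => not_congr ⟨eq_of_mem_corners_of_le hx hy, ?_⟩
  rintro rfl
  exact le_rfl

theorem exists_corner_ge (hy : y ∈ μ) : ∃ x ∈ μ.corners, y ≤ x := by
  obtain ⟨m, hym, hm⟩ := μ.cells.exists_le_maximal ((mem_cells y).2 hy)
  refine ⟨m, mem_corners.2 ⟨hm.prop, fun h => ?_, fun h => ?_⟩, hym⟩
  · have := hm.le_of_ge (y := (m.1 + 1, m.2)) h ⟨Nat.le_succ _, le_rfl⟩
    exact absurd this.1 (by simp)
  · have := hm.le_of_ge (y := (m.1, m.2 + 1)) h ⟨le_rfl, Nat.le_succ _⟩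
    exact absurd this.2 (by simp)

theorem cells_remove (hx : x ∈ μ.corners) : (μ.remove x).cells = μ.cells.erase x := by
  ext y
  rw [mem_cells, mem_remove_iff_ne hx, Finset.mem_erase, mem_cells, and_comm]

theorem card_remove_add_one (hx : x ∈ μ.corners) : (μ.remove x).card + 1 = μ.card := by
  rw [YoungDiagram.card, cells_remove hx]
  exact Finset.card_erase_add_one ((mem_cells x).2 (mem_corners.1 hx).1)

theorem mem_corners_remove_of_ne (hx : x ∈ μ.corners) (hy : y ∈ μ.corners) (h : y ≠ x) :
    y ∈ (μ.remove x).corners := by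
  obtain ⟨h0, h1, h2⟩ := mem_corners.1 hy
  exact mem_corners.2 ⟨(mem_remove_iff_ne hx).2 ⟨h0, h⟩, fun h' => h1 (mem_remove.1 h').1,
    fun h' => h2 (mem_remove.1 h').1⟩

theorem eq_of_corners_fst_eq (hx : x ∈ μ.corners) (hy : y ∈ μ.corners) (h : x.1 = y.1) :
    x = y := by
  rcases le_total x.2 y.2 with h' | h'
  · exact (eq_of_mem_corners_of_le hx (mem_corners.1 hy).1 ⟨h.le, h'⟩).symm
  · exact eq_of_mem_corners_of_le hy (mem_corners.1 hx).1 ⟨h.ge, h'⟩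

theorem rowLen_eq_of_mem_iff {ν : YoungDiagram} {i k : ℕ}
    (h : ∀ j, (i, j) ∈ μ ↔ (k, j) ∈ ν) : μ.rowLen i = ν.rowLen k :=
  le_antisymm
    (le_of_forall_lt fun j hj => mem_iff_lt_rowLen.1 ((h j).1 (mem_iff_lt_rowLen.2 hj)))
    (le_of_forall_lt fun j hj => mem_iff_lt_rowLen.1 ((h j).2 (mem_iff_lt_rowLen.2 hj)))

theorem rowLen_tail (i : ℕ) : μ.tail.rowLen i = μ.rowLen (i + 1) :=
  rowLen_eq_of_mem_iff fun _ => mem_tail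

theorem card_tail_add_rowLen : μ.tail.card + μ.rowLen 0 = μ.card := by
  have h : μ.tail.card = (μ.cells.filter fun x => ¬ x.1 = 0).card := by
    refine Finset.card_bij (fun x _ => (x.1 + 1, x.2)) ?_ ?_ ?_
    · rintro ⟨i, j⟩ h
      rw [mem_cells, mem_tail] at h
      simpa using h
    · rintro ⟨i, j⟩ _ ⟨k, l⟩ _ h
      simpa using h
    · rintro ⟨i, j⟩ h
      rw [Finset.mem_filter, mem_cells] at h
      refine ⟨(i - 1, j), ?_, ?_⟩
      · rw [mem_cells, mem_tail, Nat.sub_add_cancel (Nat.pos_of_ne_zero h.2)]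
        exact h.1
      · simpa using Nat.sub_add_cancel (Nat.pos_of_ne_zero h.2)
  rw [h, rowLen_eq_card, row, add_comm]
  exact Finset.card_filter_add_card_filter_not _

theorem rowLen_remove_of_ne (hx : x ∈ μ.corners) {i : ℕ} (h : x.1 ≠ i) :
    (μ.remove x).rowLen i = μ.rowLen i := by
  refine rowLen_eq_of_mem_iff fun j => ?_
  rw [mem_remove_iff_ne hx, and_iff_left]
  rintro rfl
  exact h rfl

theorem rowLen_of_mem_corners (hx : x ∈ μ.corners) : μ.rowLen x.1 = x.2 + 1 := by
  obtain ⟨h0, -, h2⟩ := mem_corners.1 hx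
  have h0' := mem_iff_lt_rowLen.1 (show (x.1, x.2) ∈ μ from h0)
  rw [mem_iff_lt_rowLen] at h2
  omega

theorem rowLen_remove_self (hx : x ∈ μ.corners) :
    (μ.remove x).rowLen x.1 = x.2 := by
  refine eq_of_forall_lt_iff fun j => ?_
  rw [← mem_iff_lt_rowLen, mem_remove_iff_ne hx, mem_iff_lt_rowLen, rowLen_of_mem_corners hx]
  simp only [ne_eq, Prod.ext_iff, true_and]
  omega

theorem rowLen_remove_le (hx : x ∈ μ.corners) (i : ℕ) :
    (μ.remove x).rowLen i ≤ μ.rowLen i ∧ μ.rowLen i ≤ (μ.remove x).rowLen i + 1 := by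
  by_cases h : x.1 = i
  · subst h
    rw [rowLen_remove_self hx, rowLen_of_mem_corners hx]
    omega
  · rw [rowLen_remove_of_ne hx h]
    omega

theorem mem_corners_of_rowLen_lt {i : ℕ} (h : μ.rowLen (i + 1) < μ.rowLen i) :
    (i, μ.rowLen i - 1) ∈ μ.corners := by
  simp only [mem_corners, mem_iff_lt_rowLen]
  omega

theorem mem_corners_tail {i j : ℕ} : (i, j) ∈ μ.tail.corners ↔ (i + 1, j) ∈ μ.corners := by
  simp only [mem_corners, mem_tail]

theorem tail_remove_succ (i j : ℕ) :
    (μ.remove (i + 1, j)).tail = μ.tail.remove (i, j) := by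
  ext ⟨k, l⟩
  simp only [mem_cells, mem_tail, mem_remove, Prod.mk_le_mk, add_le_add_iff_right]

theorem tail_remove_zero (hx : x ∈ μ.corners) (h : x.1 = 0) : (μ.remove x).tail = μ.tail := by
  ext ⟨k, l⟩
  simp only [mem_cells, mem_tail, mem_remove_iff_ne hx, Prod.ext_iff, ne_eq, h]
  simp

theorem mem_corners_transpose : x ∈ μ.transpose.corners ↔ x.swap ∈ μ.corners := by
  simp only [mem_corners, mem_transpose, Prod.swap_prod_mk, Prod.fst_swap, Prod.snd_swap]
  tauto

theorem corners_transpose :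
    μ.transpose.corners = μ.corners.map (Equiv.prodComm ℕ ℕ).toEmbedding := by
  ext x
  simp [mem_corners_transpose, Finset.mem_map_equiv]

theorem transpose_remove : (μ.remove x).transpose = μ.transpose.remove x.swap := by
  ext y
  rw [mem_cells, mem_cells, mem_transpose, mem_remove, mem_remove, mem_transpose,
    Prod.swap_le_swap.symm, Prod.swap_swap]

theorem card_transpose : μ.transpose.card = μ.card := by
  simp [YoungDiagram.card, transpose]

theorem card_corners_transpose : μ.transpose.corners.card = μ.corners.card := by
  rw [corners_transpose, Finset.card_map]

/-- The number of ways to strip `μ` of its cells one corner at a time. -/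
def chainCountAux : ℕ → YoungDiagram → ℕ
  | 0, _ => 1
  | n + 1, μ => ∑ x ∈ μ.corners, chainCountAux n (μ.remove x)

/-- The number of saturated chains from the empty diagram to `μ` in Young's lattice. -/
def chainCount (μ : YoungDiagram) : ℕ := chainCountAux μ.card μ

theorem corners_eq_empty (h : μ.card = 0) : μ.corners = ∅ := by
  rw [corners, Finset.card_eq_zero.1 h, Finset.filter_empty]

theorem corners_nonempty (h : μ.card ≠ 0) : μ.corners.Nonempty := by
  obtain ⟨y, hy⟩ := Finset.card_ne_zero.1 h
  obtain ⟨x, hx, -⟩ := exists_corner_ge ((mem_cells y).1 hy)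
  exact ⟨x, hx⟩

theorem chainCount_of_card_eq_zero (h : μ.card = 0) : μ.chainCount = 1 := by
  rw [chainCount, h, chainCountAux]

theorem chainCount_eq_sum (h : μ.card ≠ 0) :
    μ.chainCount = ∑ x ∈ μ.corners, (μ.remove x).chainCount := by
  obtain ⟨n, hn⟩ := Nat.exists_eq_succ_of_ne_zero h
  rw [chainCount, hn, chainCountAux]
  refine Finset.sum_congr rfl fun x hx => ?_
  rw [chainCount, ← Nat.succ_injective ((card_remove_add_one hx).trans hn)]

theorem card_induction {P : YoungDiagram → Prop}
    (step : ∀ μ, (∀ x ∈ μ.corners, P (μ.remove x)) → P μ) (μ : YoungDiagram) : P μ := by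
  induction hn : μ.card using Nat.strong_induction_on generalizing μ with
  | _ n ih =>
    exact step μ fun x hx => ih _ (by have := card_remove_add_one hx; omega) _ rfl

theorem card_ne_zero_of_mem_corners (hx : x ∈ μ.corners) : μ.card ≠ 0 := by
  have := card_remove_add_one hx
  omega

theorem chainCount_remove_le (hx : x ∈ μ.corners) : (μ.remove x).chainCount ≤ μ.chainCount := by
  rw [chainCount_eq_sum (card_ne_zero_of_mem_corners hx)]
  exact Finset.single_le_sum (f := fun x => (μ.remove x).chainCount) (fun _ _ => Nat.zero_le _) hx

theorem chainCount_pos (μ : YoungDiagram) : 0 < μ.chainCount := by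
  induction μ using card_induction with
  | step μ ih =>
    by_cases h : μ.card = 0
    · rw [chainCount_of_card_eq_zero h]
      exact one_pos
    · obtain ⟨x, hx⟩ := corners_nonempty h
      exact (ih x hx).trans_le (chainCount_remove_le hx)

theorem card_corners_le_chainCount (μ : YoungDiagram) : μ.corners.card ≤ μ.chainCount := by
  by_cases h : μ.card = 0
  · simp [corners_eq_empty h]
  · rw [chainCount_eq_sum h, Finset.card_eq_sum_ones]
    exact Finset.sum_le_sum fun x _ => chainCount_pos _

theorem chainCount_transpose (μ : YoungDiagram) : μ.transpose.chainCount = μ.chainCount := by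
  induction μ using card_induction with
  | step μ ih =>
    by_cases h : μ.card = 0
    · rw [chainCount_of_card_eq_zero h, chainCount_of_card_eq_zero (card_transpose.trans h)]
    · rw [chainCount_eq_sum h, chainCount_eq_sum (card_transpose.trans_ne h), corners_transpose,
        Finset.sum_map]
      refine Finset.sum_congr rfl fun x hx => ?_
      rw [← ih x hx, transpose_remove]
      rfl

end YoungDiagram

/-- The ballot numbers: `ballot r k` is the number of standard Young tableaux with two rows, of
lengths `r` and `k`, and `0` if `r < k`. -/
def ballot : ℕ → ℕ → ℕ
  | _, 0 => 1
  | 0, _ + 1 => 0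
  | r + 1, k + 1 => if r < k then 0 else ballot r (k + 1) + ballot (r + 1) k

theorem ballot_zero_right (r : ℕ) : ballot r 0 = 1 := by
  cases r <;> rw [ballot]

theorem ballot_add_choose {r k : ℕ} (h : k ≤ r) :
    ballot r (k + 1) + (r + k + 1).choose k = (r + k + 1).choose (k + 1) := by
  induction r generalizing k with
  | zero =>
    obtain rfl : k = 0 := by omega
    simp [ballot]
  | succ r ihr =>
    induction k with
    | zero =>
      have := ihr (Nat.zero_le r)
      simp only [zero_add, add_zero, Nat.choose_zero_right, Nat.choose_one_right] at this
      simp only [ballot, ballot_zero_right, Nat.not_lt_zero, if_false, zero_add, add_zero,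
        Nat.choose_zero_right, Nat.choose_one_right, this]
    | succ k ihk =>
      rw [ballot]
      split_ifs with hlt
      · obtain rfl : k = r := by omega
        rw [zero_add]
        exact (Nat.choose_symm_of_eq_add (by omega)).symm
      · have h1 := ihr (k := k + 1) (by omega)
        have h2 := ihk (by omega)
        have e : r + (k + 1) + 1 = r + 1 + k + 1 := by omega
        have e' : r + 1 + (k + 1) + 1 = r + 1 + k + 1 + 1 := by omega
        rw [e] at h1
        rw [e', Nat.choose_succ_succ' _ (k + 1), Nat.choose_succ_succ' _ k]
        omega

theorem ballot_mul_succ {r k : ℕ} (h : k ≤ r) :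
    ballot r k * (r + 1) = (r + k).choose k * (r + 1 - k) := by
  cases k with
  | zero => simp [ballot_zero_right]
  | succ k =>
    have h1 := ballot_add_choose (r := r) (k := k) (by omega)
    have h2 := Nat.choose_succ_right_eq (r + k + 1) k
    rw [show r + k + 1 - k = r + 1 by omega] at h2
    obtain ⟨d, rfl⟩ := Nat.exists_eq_add_of_le h
    rw [show k + 1 + d + 1 - (k + 1) = d + 1 by omega,
      show k + 1 + d + (k + 1) = k + 1 + d + k + 1 by omega, ← h1]
    rw [← h1] at h2
    nlinarith

theorem ballot_eq_div {r k : ℕ} (h : k ≤ r) :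
    ballot r k = (r + k).choose k * (r + 1 - k) / (r + 1) := by
  rw [← ballot_mul_succ h, Nat.mul_div_cancel _ r.succ_pos]

theorem ballot_self (r : ℕ) : ballot (r + 1) (r + 1) = ballot (r + 1) r := by
  cases r with
  | zero => simp [ballot]
  | succ r =>
    rw [ballot, if_neg (lt_irrefl _), ballot, if_pos (Nat.lt_succ_self _), zero_add]

namespace YoungDiagram

variable {μ : YoungDiagram} {x : ℕ × ℕ}

theorem sum_corners_tail_add_le (f : YoungDiagram → ℕ) :
    ∑ y ∈ μ.tail.corners, f (μ.remove (y.1 + 1, y.2)) ≤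
      ∑ x ∈ μ.corners with x.1 ≠ 0, f (μ.remove x) := by
  rw [← Finset.sum_image (f := fun x => f (μ.remove x)) injective_shift.injOn]
  refine Finset.sum_le_sum_of_subset fun x hx => ?_
  obtain ⟨⟨i, j⟩, hy, rfl⟩ := Finset.mem_image.1 hx
  exact Finset.mem_filter.2 ⟨mem_corners_tail.1 hy, Nat.succ_ne_zero _⟩

/-- Deleting a first row that contains at least half of the cells. -/
theorem chainCount_tail_mul_ballot_le (μ : YoungDiagram) (h : μ.tail.card ≤ μ.rowLen 0) :
    μ.tail.chainCount * ballot (μ.rowLen 0) μ.tail.card ≤ μ.chainCount := by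
  induction μ using card_induction with
  | step μ ih =>
    by_cases hk : μ.tail.card = 0
    · rw [hk, ballot_zero_right, chainCount_of_card_eq_zero hk]
      exact chainCount_pos μ
    have hcard := μ.card_tail_add_rowLen
    have hlower : ∀ y ∈ μ.tail.corners,
        (μ.tail.remove y).chainCount * ballot (μ.rowLen 0) (μ.tail.card - 1) ≤
          (μ.remove (y.1 + 1, y.2)).chainCount := by
      intro y hy
      have hy' := mem_corners_tail.1 hy
      have h1 := ih _ hy'
      have h2 : (μ.tail.remove (y.1, y.2)).card + 1 = _ := card_remove_add_one hy
      rw [tail_remove_succ, rowLen_remove_of_ne hy' (Nat.succ_ne_zero _),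
        show (μ.tail.remove (y.1, y.2)).card = μ.tail.card - 1 by omega] at h1
      exact h1 (by omega)
    have hsum : μ.tail.chainCount * ballot (μ.rowLen 0) (μ.tail.card - 1) ≤
        ∑ x ∈ μ.corners with x.1 ≠ 0, (μ.remove x).chainCount := by
      rw [chainCount_eq_sum hk, Finset.sum_mul]
      exact (Finset.sum_le_sum hlower).trans (sum_corners_tail_add_le _)
    rw [μ.chainCount_eq_sum (by omega), ← Finset.sum_filter_add_sum_filter_not μ.corners
      (fun x => x.1 = 0)]
    obtain ⟨r, hr⟩ : ∃ r, μ.rowLen 0 = r + 1 := Nat.exists_eq_succ_of_ne_zero (by omega)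
    obtain ⟨k, hk'⟩ := Nat.exists_eq_succ_of_ne_zero hk
    rw [hr, hk', Nat.succ_sub_one] at hsum
    rw [hr, hk', Nat.succ_eq_add_one]
    rcases (show k = r ∨ k + 1 ≤ r by omega) with rfl | hlt
    · rw [ballot_self]
      exact hsum.trans (Nat.le_add_left _ _)
    · rw [ballot, if_neg (by omega), mul_add]
      refine add_le_add ?_ hsum
      have hx : (0, μ.rowLen 0 - 1) ∈ μ.corners := by
        refine mem_corners_of_rowLen_lt ?_
        have := μ.tail.card_tail_add_rowLen
        rw [rowLen_tail] at this
        omega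
      have h1 := ih _ hx
      have h2 := rowLen_remove_self hx
      rw [tail_remove_zero hx rfl, h2, hk', hr, Nat.add_sub_cancel] at h1
      refine (h1 (by omega)).trans ?_
      exact Finset.single_le_sum (f := fun x => (μ.remove x).chainCount)
        (fun _ _ => Nat.zero_le _) (Finset.mem_filter.2 ⟨by simpa [hr] using hx, rfl⟩)

theorem ballot_le_chainCount {r k : ℕ} (hr : μ.rowLen 0 = r) (hk : μ.card = r + k) (h : k ≤ r) :
    ballot r k ≤ μ.chainCount := by
  have h1 := μ.card_tail_add_rowLen
  obtain rfl : k = μ.tail.card := by omega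
  subst hr
  exact (Nat.le_mul_of_pos_left _ (chainCount_pos _)).trans (μ.chainCount_tail_mul_ballot_le h)

theorem card_le_rowLen_mul_colLen (μ : YoungDiagram) : μ.card ≤ μ.colLen 0 * μ.rowLen 0 := by
  rw [← Finset.card_range (μ.colLen 0), ← Finset.card_range (μ.rowLen 0),
    ← Finset.card_product]
  refine Finset.card_le_card fun x hx => ?_
  rw [Finset.mem_product, Finset.mem_range, Finset.mem_range, ← mem_iff_lt_colLen,
    ← mem_iff_lt_rowLen]
  exact ⟨μ.up_left_mem le_rfl (Nat.zero_le _) hx, μ.up_left_mem (Nat.zero_le _) le_rfl hx⟩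

theorem card_corners_le_colLen (μ : YoungDiagram) : μ.corners.card ≤ μ.colLen 0 := by
  rw [← Finset.card_range (μ.colLen 0)]
  refine Finset.card_le_card_of_injOn Prod.fst (fun x hx => ?_)
    fun x hx y hy h => eq_of_corners_fst_eq hx hy h
  rw [Finset.coe_range, Set.mem_Iio, ← mem_iff_lt_colLen]
  exact μ.up_left_mem le_rfl (Nat.zero_le _) (mem_corners.1 hx).1

theorem card_corners_le_card_corners_tail_add_one (μ : YoungDiagram) :
    μ.corners.card ≤ μ.tail.corners.card + 1 := by
  rw [← Finset.card_filter_add_card_filter_not (fun x : ℕ × ℕ => x.1 = 0), add_comm]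
  refine add_le_add ?_ ?_
  · rw [← Finset.card_image_of_injective μ.tail.corners injective_shift]
    refine Finset.card_le_card fun x hx => ?_
    obtain ⟨hx, h0⟩ := Finset.mem_filter.1 hx
    refine Finset.mem_image.2 ⟨(x.1 - 1, x.2), ?_, ?_⟩
    · rw [mem_corners_tail, Nat.sub_add_cancel (Nat.pos_of_ne_zero h0)]
      exact hx
    · simp only [Nat.sub_add_cancel (Nat.pos_of_ne_zero h0)]
  · refine Finset.card_le_one.2 fun x hx y hy => ?_
    obtain ⟨hx, hx0⟩ := Finset.mem_filter.1 hx
    obtain ⟨hy, hy0⟩ := Finset.mem_filter.1 hy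
    exact eq_of_corners_fst_eq hx hy (hx0.trans hy0.symm)

theorem mem_corners_remove_up {a b : ℕ} (hx : (a + 1, b) ∈ μ.corners) (h : (a, b + 1) ∉ μ) :
    (a, b) ∈ (μ.remove (a + 1, b)).corners := by
  have hm := (mem_corners.1 hx).1
  simp only [mem_corners, mem_remove, Prod.mk_le_mk]
  exact ⟨⟨μ.up_left_mem (Nat.le_succ _) le_rfl hm, by omega⟩, by simp, fun h' => h h'.1⟩

theorem mem_corners_remove_left {a b : ℕ} (hx : (a, b + 1) ∈ μ.corners) (h : (a + 1, b) ∉ μ) :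
    (a, b) ∈ (μ.remove (a, b + 1)).corners := by
  have hm := (mem_corners.1 hx).1
  simp only [mem_corners, mem_remove, Prod.mk_le_mk]
  exact ⟨⟨μ.up_left_mem le_rfl (Nat.le_succ _) hm, by omega⟩, fun h' => h h'.1, by simp⟩

/-- Removing a corner `x` destroys the corner `x` only, and uncovers the cells above and to the
left of `x` if nothing else covers them. -/
theorem le_card_corners_remove (hx : x ∈ μ.corners) :
    μ.corners.card + (if 1 ≤ x.1 ∧ (x.1 - 1, x.2 + 1) ∉ μ then 1 else 0) +
      (if 1 ≤ x.2 ∧ (x.1 + 1, x.2 - 1) ∉ μ then 1 else 0) ≤ (μ.remove x).corners.card + 1 := by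
  obtain ⟨a, b⟩ := x
  let A : Finset (ℕ × ℕ) := if 1 ≤ a ∧ (a - 1, b + 1) ∉ μ then {(a - 1, b)} else ∅
  let B : Finset (ℕ × ℕ) := if 1 ≤ b ∧ (a + 1, b - 1) ∉ μ then {(a, b - 1)} else ∅
  have memA {p : ℕ × ℕ} : p ∈ A ↔ (1 ≤ a ∧ (a - 1, b + 1) ∉ μ) ∧ p = (a - 1, b) := by
    by_cases h : 1 ≤ a ∧ (a - 1, b + 1) ∉ μ <;> simp [A, h]
  have memB {p : ℕ × ℕ} : p ∈ B ↔ (1 ≤ b ∧ (a + 1, b - 1) ∉ μ) ∧ p = (a, b - 1) := by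
    by_cases h : 1 ≤ b ∧ (a + 1, b - 1) ∉ μ <;> simp [B, h]
  have cardA : A.card = if 1 ≤ a ∧ (a - 1, b + 1) ∉ μ then 1 else 0 := by
    simp only [A]; split_ifs <;> simp
  have cardB : B.card = if 1 ≤ b ∧ (a + 1, b - 1) ∉ μ then 1 else 0 := by
    simp only [B]; split_ifs <;> simp
  have disjAB : Disjoint A B := by
    refine Finset.disjoint_left.2 fun p hp hp' => ?_
    obtain ⟨⟨h1, -⟩, rfl⟩ := memA.1 hp
    have := congrArg Prod.fst (memB.1 hp').2
    simp only at this
    omega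
  have disj : Disjoint (μ.corners.erase (a, b)) (A ∪ B) := by
    refine Finset.disjoint_left.2 fun p hp hp' => ?_
    have hle : p ≤ (a, b) := by
      rcases Finset.mem_union.1 hp' with h | h
      · rw [(memA.1 h).2]
        exact ⟨Nat.sub_le _ _, le_rfl⟩
      · rw [(memB.1 h).2]
        exact ⟨le_rfl, Nat.sub_le _ _⟩
    exact (Finset.mem_erase.1 hp).1
      (eq_of_mem_corners_of_le (Finset.mem_erase.1 hp).2 (mem_corners.1 hx).1 hle).symm
  have hsub : μ.corners.erase (a, b) ∪ (A ∪ B) ⊆ (μ.remove (a, b)).corners := by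
    intro p hp
    rcases Finset.mem_union.1 hp with h | h
    · exact mem_corners_remove_of_ne hx (Finset.mem_erase.1 h).2 (Finset.mem_erase.1 h).1
    rcases Finset.mem_union.1 h with h | h
    · obtain ⟨⟨h1, h2⟩, rfl⟩ := memA.1 h
      obtain ⟨a, rfl⟩ := Nat.exists_eq_add_of_le' h1
      exact mem_corners_remove_up hx h2
    · obtain ⟨⟨h1, h2⟩, rfl⟩ := memB.1 h
      obtain ⟨b, rfl⟩ := Nat.exists_eq_add_of_le' h1
      exact mem_corners_remove_left hx h2
  have := Finset.card_le_card hsub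
  rw [Finset.card_union_of_disjoint disj, Finset.card_union_of_disjoint disjAB, cardA,
    cardB] at this
  have := Finset.card_erase_add_one hx
  simp only
  omega

theorem two_le_card_corners_remove (h : μ.corners = {x}) (hr : 2 ≤ μ.rowLen 0)
    (hc : 2 ≤ μ.colLen 0) : 2 ≤ (μ.remove x).corners.card := by
  have hx : x ∈ μ.corners := h ▸ Finset.mem_singleton_self x
  have hle {y : ℕ × ℕ} (hy : y ∈ μ) : y ≤ x := by
    obtain ⟨z, hz, hyz⟩ := exists_corner_ge hy
    rw [h, Finset.mem_singleton] at hz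
    exact hz ▸ hyz
  have h1 : 1 ≤ x.1 := (hle (mem_iff_lt_colLen.2 hc : (1, 0) ∈ μ)).1
  have h2 : 1 ≤ x.2 := (hle (mem_iff_lt_rowLen.2 hr : (0, 1) ∈ μ)).2
  have h3 := le_card_corners_remove hx
  rw [if_pos ⟨h1, fun h => absurd (hle h).2 (by simp)⟩,
    if_pos ⟨h2, fun h => absurd (hle h).1 (by simp)⟩, h, Finset.card_singleton] at h3
  omega

theorem four_le_card_corners_remove_add {y : ℕ × ℕ} (h : μ.corners = {x, y}) (hxy : x.1 < y.1)
    (hr : 3 ≤ μ.rowLen 0) (hc : 3 ≤ μ.colLen 0) :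
    4 ≤ (μ.remove x).corners.card + (μ.remove y).corners.card := by
  have hx : x ∈ μ.corners := h ▸ Finset.mem_insert_self _ _
  have hy : y ∈ μ.corners := h ▸ Finset.mem_insert_of_mem (Finset.mem_singleton_self _)
  have hyx : y.2 < x.2 := by
    by_contra! h'
    exact hxy.ne' (congrArg Prod.fst
      (eq_of_mem_corners_of_le hx (mem_corners.1 hy).1 ⟨hxy.le, h'⟩))
  have hle {z : ℕ × ℕ} (hz : z ∈ μ) : z ≤ x ∨ z ≤ y := by
    obtain ⟨w, hw, hzw⟩ := exists_corner_ge hz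
    rw [h, Finset.mem_insert, Finset.mem_singleton] at hw
    rcases hw with rfl | rfl
    exacts [Or.inl hzw, Or.inr hzw]
  have hx2 : 2 ≤ x.2 := by
    rcases hle (mem_iff_lt_rowLen.2 hr : (0, 2) ∈ μ) with h | h <;> have := h.2 <;> omega
  have hy1 : 2 ≤ y.1 := by
    rcases hle (mem_iff_lt_colLen.2 hc : (2, 0) ∈ μ) with h | h <;> have := h.1 <;> omega
  have h1 := le_card_corners_remove hx
  have h2 := le_card_corners_remove hy
  rw [h, Finset.card_pair (fun e => hxy.ne (congrArg Prod.fst e))] at h1 h2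
  have hx_up : (x.1 - 1, x.2 + 1) ∉ μ := fun h => by
    rcases hle h with h | h <;> have := h.2 <;> simp only at this <;> omega
  have hy_left : (y.1 + 1, y.2 - 1) ∉ μ := fun h => by
    rcases hle h with h | h <;> have := h.1 <;> simp only at this <;> omega
  have hx_left (h' : y.2 + 2 ≤ x.2) : (x.1 + 1, x.2 - 1) ∉ μ := fun h => by
    rcases hle h with ⟨h3, h4⟩ | ⟨h3, h4⟩ <;> simp only at h3 h4 <;> omega
  have hy_up (h' : x.1 + 2 ≤ y.1) : (y.1 - 1, y.2 + 1) ∉ μ := fun h => by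
    rcases hle h with ⟨h3, h4⟩ | ⟨h3, h4⟩ <;> simp only at h3 h4 <;> omega
  simp only [hx_up, hy_left, not_false_eq_true, and_true] at h1 h2
  by_cases ha : 1 ≤ x.1
  · rw [if_pos ha] at h1
    by_cases hb : 1 ≤ y.2
    · rw [if_pos hb] at h2
      omega
    · rw [if_pos (c := 1 ≤ x.2 ∧ _) ⟨by omega, hx_left (by omega)⟩] at h1
      omega
  · rw [if_pos ⟨by omega, hy_up (by omega)⟩] at h2
    by_cases hb : 1 ≤ y.2
    · rw [if_pos hb] at h2
      omega
    · rw [if_pos (c := 1 ≤ x.2 ∧ _) ⟨by omega, hx_left (by omega)⟩] at h1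
      omega

theorem two_mul_card_corners_le_sum (hr : 3 ≤ μ.rowLen 0) (hc : 3 ≤ μ.colLen 0) :
    2 * μ.corners.card ≤ ∑ x ∈ μ.corners, (μ.remove x).corners.card := by
  rcases (show μ.corners.card = 0 ∨ μ.corners.card = 1 ∨ μ.corners.card = 2 ∨
    3 ≤ μ.corners.card by omega) with h | h | h | h
  · simp [h]
  · obtain ⟨x, hx⟩ := Finset.card_eq_one.1 h
    rw [h, hx, Finset.sum_singleton]
    exact two_le_card_corners_remove hx (by omega) (by omega)
  · obtain ⟨x, y, hxy, e⟩ := Finset.card_eq_two.1 h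
    have hx : x ∈ μ.corners := e ▸ Finset.mem_insert_self _ _
    have hy : y ∈ μ.corners := e ▸ Finset.mem_insert_of_mem (Finset.mem_singleton_self _)
    rw [h, e, Finset.sum_pair hxy]
    rcases lt_trichotomy x.1 y.1 with hlt | heq | hlt
    · exact four_le_card_corners_remove_add e hlt hr hc
    · exact absurd (eq_of_corners_fst_eq hx hy heq) hxy
    · rw [add_comm]
      exact four_le_card_corners_remove_add (e.trans (Finset.pair_comm _ _)) hlt hr hc
  · have : ∀ x ∈ μ.corners, 2 ≤ (μ.remove x).corners.card := fun x hx => by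
      have := le_card_corners_remove hx
      omega
    simpa [mul_comm] using Finset.card_nsmul_le_sum _ _ _ this

theorem mul_ballot_le_chainCount_of_three_rows {r : ℕ} (hr : 3 ≤ r) (μ : YoungDiagram)
    (h0 : μ.rowLen 0 = r) (h1 : r ≤ μ.rowLen 1 + 2) (h2 : μ.rowLen 2 = 1) (h3 : μ.rowLen 3 = 0) :
    (r - 2) * ballot r (r - 1) ≤ μ.chainCount := by
  induction μ using card_induction with
  | step μ ih =>
    rcases (show μ.rowLen 1 = r - 2 ∨ r - 1 ≤ μ.rowLen 1 by omega) with h | h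
    · have c1 := μ.tail.tail.card_tail_add_rowLen
      have c2 := μ.tail.card_tail_add_rowLen
      have c3 := μ.tail.tail.tail.card_le_rowLen_mul_colLen
      simp only [rowLen_tail, zero_add, Nat.reduceAdd, h, h2, h3, mul_zero,
        Nat.le_zero] at c1 c2 c3
      have e : μ.tail.card = r - 1 := by omega
      have b1 := ballot_le_chainCount (μ := μ.tail) (r := r - 2) (k := 1)
        ((rowLen_tail 0).trans h) (by omega) (by omega)
      have b2 := ballot_add_choose (r := r - 2) (k := 0) (Nat.zero_le _)
      simp only [zero_add, add_zero, Nat.choose_zero_right, Nat.choose_one_right] at b2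
      have b3 := μ.chainCount_tail_mul_ballot_le (by omega)
      rw [e, h0] at b3
      exact (Nat.mul_le_mul_right _ (by omega)).trans b3
    · have hx := mem_corners_of_rowLen_lt (μ := μ) (i := 1)
        (h2.trans_lt (by omega : 1 < μ.rowLen 1))
      have e1 := rowLen_remove_self hx
      simp only at e1
      refine (ih _ hx ?_ ?_ ?_ ?_).trans (chainCount_remove_le hx)
      · rw [rowLen_remove_of_ne hx (by simp), h0]
      · omega
      · rw [rowLen_remove_of_ne hx (by simp), h2]
      · rw [rowLen_remove_of_ne hx (by simp), h3]

theorem rowLen_eq_zero_of_colLen_le {i : ℕ} (h : μ.colLen 0 ≤ i) : μ.rowLen i = 0 := by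
  by_contra h'
  have := mem_iff_lt_colLen.1 (mem_iff_lt_rowLen.2 (Nat.pos_of_ne_zero h'))
  omega

theorem card_corners_mul_two_pow_le_of_three_rows {r : ℕ} (hr : 3 ≤ r) (hr' : r ≤ 20)
    (h0 : μ.rowLen 0 = r) (hc : μ.colLen 0 = 3) (h2 : μ.rowLen 2 = 1)
    (hn : 2 * r ≤ μ.card + 1) :
    μ.corners.card * 2 ^ μ.card ≤ 128 * μ.chainCount := by
  have h3 : μ.rowLen 3 = 0 := rowLen_eq_zero_of_colLen_le hc.le
  have c0 := μ.card_tail_add_rowLen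
  have c1 := μ.tail.card_tail_add_rowLen
  have c2 := μ.tail.tail.card_tail_add_rowLen
  have c3 := μ.tail.tail.tail.card_le_rowLen_mul_colLen
  simp only [rowLen_tail, zero_add, Nat.reduceAdd, h2, h3, mul_zero, Nat.le_zero] at c0 c1 c2 c3
  have h1 := μ.rowLen_anti 0 1 (Nat.zero_le _)
  have ht := hc ▸ μ.card_corners_le_colLen
  have key := mul_ballot_le_chainCount_of_three_rows hr μ h0 (by omega) h2 h3
  calc μ.corners.card * 2 ^ μ.card ≤ 3 * 2 ^ (2 * r + 1) :=
        Nat.mul_le_mul ht (Nat.pow_le_pow_right two_pos (by omega))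
    _ ≤ 128 * ((r - 2) * ballot r (r - 1)) := by
        rw [ballot_eq_div (Nat.sub_le _ _)]
        clear * - hr hr'
        interval_cases r <;> norm_num [Nat.choose]
    _ ≤ _ := Nat.mul_le_mul_left _ key

theorem card_corners_mul_two_pow_le_of_long_row {r : ℕ} (hr : 3 ≤ r) (hr' : r ≤ 20)
    (h0 : μ.rowLen 0 = r) (hn : μ.card + 2 = 2 * r) :
    μ.corners.card * 2 ^ μ.card ≤ 128 * μ.chainCount := by
  have hcard := μ.card_tail_add_rowLen
  have hk : μ.tail.card = r - 2 := by omega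
  have h1 := μ.chainCount_tail_mul_ballot_le (by omega)
  rw [h0, hk] at h1
  have h2 := μ.card_corners_le_card_corners_tail_add_one
  have h3 := μ.tail.card_corners_le_chainCount
  have h4 := Finset.card_pos.2 (corners_nonempty (μ := μ.tail) (by omega))
  have h5 : 2 ^ (2 * r - 2) ≤ 64 * ballot r (r - 2) := by
    rw [ballot_eq_div (Nat.sub_le _ _)]
    clear * - hr hr'
    interval_cases r <;> norm_num [Nat.choose]
  calc μ.corners.card * 2 ^ μ.card ≤ (2 * μ.tail.chainCount) * (64 * ballot r (r - 2)) :=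
        Nat.mul_le_mul (by omega) ((show μ.card = 2 * r - 2 by omega) ▸ h5)
    _ = 128 * (μ.tail.chainCount * ballot r (r - 2)) := by ring
    _ ≤ _ := Nat.mul_le_mul_left _ h1

theorem colLen_remove_le (hx : x ∈ μ.corners) (j : ℕ) :
    (μ.remove x).colLen j ≤ μ.colLen j ∧ μ.colLen j ≤ (μ.remove x).colLen j + 1 := by
  have := rowLen_remove_le (mem_corners_transpose.2 (x.swap_swap.symm ▸ hx)) j
  rwa [← transpose_remove, rowLen_transpose, rowLen_transpose] at this

/-- If removing a corner shortens the first row, then the last column has one cell. -/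
theorem colLen_eq_one_of_rowLen_remove_lt (hx : x ∈ μ.corners)
    (h : (μ.remove x).rowLen 0 < μ.rowLen 0) : μ.colLen (μ.rowLen 0 - 1) = 1 := by
  have h0 : x.1 = 0 := by
    by_contra h0
    exact h.ne (rowLen_remove_of_ne hx h0)
  have h1 := rowLen_of_mem_corners hx
  obtain ⟨hm, hd, -⟩ := mem_corners.1 hx
  have h3 : (x.1, x.2) ∈ μ := hm
  rw [h0] at h1 hd h3
  rw [mem_iff_lt_colLen] at hd h3
  rw [h1, Nat.add_sub_cancel]
  omega

theorem card_corners_mul_two_pow_le (μ : YoungDiagram) (hn : μ.card ≤ 39) (hr : 3 ≤ μ.rowLen 0)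
    (hc : 3 ≤ μ.colLen 0) (hr' : 2 * μ.rowLen 0 ≤ μ.card + 1)
    (hc' : 2 * μ.colLen 0 ≤ μ.card + 1) :
    μ.corners.card * 2 ^ μ.card ≤ 128 * μ.chainCount := by
  induction μ using card_induction with
  | step μ ih =>
    by_cases hrow : μ.colLen 0 = 3 ∧ μ.rowLen 2 = 1
    · exact card_corners_mul_two_pow_le_of_three_rows hr (by omega) rfl hrow.1 hrow.2 hr'
    by_cases hcol : μ.rowLen 0 = 3 ∧ μ.colLen 2 = 1
    · have := card_corners_mul_two_pow_le_of_three_rows (μ := μ.transpose) hc (by omega)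
        (rowLen_transpose _ _) ((colLen_transpose _ _).trans hcol.1)
        ((rowLen_transpose _ _).trans hcol.2) (card_transpose.symm ▸ hc')
      rwa [card_corners_transpose, card_transpose, chainCount_transpose] at this
    have hchild : ∀ x ∈ μ.corners, (μ.remove x).corners.card * 2 ^ (μ.remove x).card ≤
        128 * (μ.remove x).chainCount := by
      intro x hx
      have h1 := card_remove_add_one hx
      obtain ⟨h2, h2'⟩ := rowLen_remove_le hx 0
      obtain ⟨h3, h3'⟩ := colLen_remove_le hx 0
      have h4 : 3 ≤ (μ.remove x).rowLen 0 := by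
        by_contra! h
        have e : μ.rowLen 0 = 3 := by omega
        have := colLen_eq_one_of_rowLen_remove_lt hx (by omega)
        rw [e] at this
        exact hcol ⟨e, this⟩
      have h5 : 3 ≤ (μ.remove x).colLen 0 := by
        by_contra! h
        have e : μ.colLen 0 = 3 := by omega
        have := colLen_eq_one_of_rowLen_remove_lt (mem_corners_transpose.2 (x.swap_swap.symm ▸ hx))
          (by rw [← transpose_remove, rowLen_transpose, rowLen_transpose]; omega)
        rw [rowLen_transpose, colLen_transpose, e] at this
        exact hrow ⟨e, this⟩
      by_cases h6 : (μ.remove x).card + 2 = 2 * (μ.remove x).rowLen 0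
      · exact card_corners_mul_two_pow_le_of_long_row h4 (by omega) rfl h6
      by_cases h7 : (μ.remove x).card + 2 = 2 * (μ.remove x).colLen 0
      · have := card_corners_mul_two_pow_le_of_long_row (μ := (μ.remove x).transpose) h5
          (by omega) (rowLen_transpose _ _) (card_transpose.symm ▸ h7)
        rwa [card_corners_transpose, card_transpose, chainCount_transpose] at this
      exact ih x hx (by omega) h4 h5 (by omega) (by omega)
    have hne : μ.card ≠ 0 := by omega
    obtain ⟨n, hn'⟩ := Nat.exists_eq_succ_of_ne_zero hne
    calc μ.corners.card * 2 ^ μ.card = 2 * μ.corners.card * 2 ^ n := by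
          rw [hn', pow_succ]
          ring
      _ ≤ (∑ x ∈ μ.corners, (μ.remove x).corners.card) * 2 ^ n :=
          Nat.mul_le_mul_right _ (two_mul_card_corners_le_sum hr hc)
      _ ≤ 128 * μ.chainCount := by
          rw [chainCount_eq_sum hne, Finset.sum_mul, Finset.mul_sum]
          refine Finset.sum_le_sum fun x hx => ?_
          have h1 := card_remove_add_one hx
          have := hchild x hx
          rwa [show (μ.remove x).card = n by omega] at this

/-- Extends a filling of `μ.remove x` to `μ` by putting the largest entry into `x`. -/
def extendFun (hx : x ∈ μ.corners)
    (T : {y // y ∈ (μ.remove x).cells} ≃ Fin (μ.remove x).card) (y : {y // y ∈ μ.cells}) :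
    Fin μ.card :=
  if h : y.1 = x then ⟨(μ.remove x).card, by have := card_remove_add_one hx; omega⟩
  else ⟨T ⟨y.1, (mem_remove_iff_ne hx).2 ⟨y.2, h⟩⟩,
    (T _).2.trans (by have := card_remove_add_one hx; omega)⟩

variable {hx : x ∈ μ.corners} {T : {y // y ∈ (μ.remove x).cells} ≃ Fin (μ.remove x).card}

theorem extendFun_self {y : {y // y ∈ μ.cells}} (h : y.1 = x) :
    (extendFun hx T y : ℕ) = (μ.remove x).card := by
  rw [extendFun, dif_pos h]

theorem extendFun_of_ne {y : {y // y ∈ μ.cells}} (h : y.1 ≠ x) :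
    (extendFun hx T y : ℕ) = T ⟨y.1, (mem_remove_iff_ne hx).2 ⟨y.2, h⟩⟩ := by
  rw [extendFun, dif_neg h]

theorem extendFun_lt_of_ne {y : {y // y ∈ μ.cells}} (h : y.1 ≠ x) :
    (extendFun hx T y : ℕ) < (μ.remove x).card := by
  rw [extendFun_of_ne h]
  exact Fin.is_lt _

theorem extendFun_eq_card_iff {y : {y // y ∈ μ.cells}} :
    (extendFun hx T y : ℕ) = (μ.remove x).card ↔ y.1 = x :=
  ⟨fun h => by_contra fun h' => (extendFun_lt_of_ne h').ne h, extendFun_self⟩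

theorem extendFun_injective : Function.Injective (extendFun hx T) := by
  intro y z h
  have h' := congrArg Fin.val h
  by_cases hy : y.1 = x
  · have hz := extendFun_eq_card_iff.1 (h'.symm.trans (extendFun_self hy))
    exact Subtype.ext (hy.trans hz.symm)
  · have hz : z.1 ≠ x := fun hz => hy (extendFun_eq_card_iff.1 (h'.trans (extendFun_self hz)))
    rw [extendFun_of_ne hy, extendFun_of_ne hz] at h'
    exact Subtype.ext (Subtype.mk.inj (T.injective (Fin.ext h')))

theorem extendFun_bijective : Function.Bijective (extendFun hx T) :=
  (Fintype.bijective_iff_injective_and_card _).2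
    ⟨extendFun_injective, by rw [Fintype.card_coe, Fintype.card_fin]⟩

theorem extendFun_lt {y z : {y // y ∈ μ.cells}} (hyz : y.1 ≤ z.1) (hne : y ≠ z)
    (h : ∀ a b : {y // y ∈ (μ.remove x).cells}, a.1 = y.1 → b.1 = z.1 → T a < T b) :
    extendFun hx T y < extendFun hx T z := by
  have hy : y.1 ≠ x := by
    rintro rfl
    exact hne (Subtype.ext (eq_of_mem_corners_of_le hx z.2 hyz).symm)
  by_cases hz : z.1 = x
  · rw [Fin.lt_def, extendFun_self hz]
    exact extendFun_lt_of_ne hy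
  · rw [Fin.lt_def, extendFun_of_ne hy, extendFun_of_ne hz]
    exact h _ _ rfl rfl

theorem isStandardYT_extend (hT : IsStandardYT (μ.remove x) T) :
    IsStandardYT μ (Equiv.ofBijective _ (extendFun_bijective (hx := hx) (T := T))) := by
  refine ⟨fun y z h1 h2 => ?_, fun y z h1 h2 => ?_⟩
  · refine extendFun_lt (hx := hx) ⟨h1.le, h2.le⟩ (by rintro rfl; exact h2.false) fun a b ha hb => ?_
    exact hT.1 a b (by rw [ha, hb, h1]) (by rwa [ha, hb])
  · refine extendFun_lt (hx := hx) ⟨h2.le, h1.le⟩ (by rintro rfl; exact h2.false) fun a b ha hb => ?_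
    exact hT.2 a b (by rw [ha, hb, h1]) (by rwa [ha, hb])

/-- Extension of tableaux, from all diagrams obtained by removing a corner of `μ`. -/
noncomputable def extend (p : Σ x : {x // x ∈ μ.corners},
      {T : {y // y ∈ (μ.remove x).cells} ≃ Fin (μ.remove x).card // IsStandardYT (μ.remove x) T}) :
    {T : {y // y ∈ μ.cells} ≃ Fin μ.card // IsStandardYT μ T} :=
  ⟨Equiv.ofBijective _ (extendFun_bijective (hx := p.1.2) (T := p.2.1)),
    isStandardYT_extend p.2.2⟩

theorem extend_injective : Function.Injective (extend (μ := μ)) := by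
  rintro ⟨⟨x, hx⟩, T, hT⟩ ⟨⟨x', hx'⟩, T', hT'⟩ h
  have key (y : {y // y ∈ μ.cells}) : (extendFun hx T y : ℕ) = extendFun hx' T' y :=
    congrArg Fin.val (DFunLike.congr_fun (congrArg Subtype.val h) y)
  obtain rfl : x = x' := by
    have h1 := key ⟨x, (mem_corners.1 hx).1⟩
    have h2 := card_remove_add_one hx
    have h3 := card_remove_add_one hx'
    exact extendFun_eq_card_iff.1
      ((h1.symm.trans (extendFun_self (hx := hx) rfl)).trans (by omega))
  obtain rfl : T = T' := by
    ext ⟨y, hy⟩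
    obtain ⟨h1, h2⟩ := (mem_remove_iff_ne hx).1 hy
    have := key ⟨y, h1⟩
    exact (extendFun_of_ne (hx := hx) h2).symm.trans (this.trans (extendFun_of_ne (hx := hx) h2))
  rfl

theorem chainCount_le_card_isStandardYT (μ : YoungDiagram) :
    μ.chainCount ≤ Nat.card {T : {y // y ∈ μ.cells} ≃ Fin μ.card // IsStandardYT μ T} := by
  induction μ using card_induction with
  | step μ ih =>
    by_cases h : μ.card = 0
    · have hempty (a : {y // y ∈ μ.cells}) : False :=
        Finset.notMem_empty a.1 (Finset.card_eq_zero.1 h ▸ a.2)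
      rw [chainCount_of_card_eq_zero h, Nat.one_le_iff_ne_zero, Nat.card_ne_zero]
      exact ⟨⟨μ.cells.equivFin, fun a => (hempty a).elim, fun a => (hempty a).elim⟩,
        inferInstance⟩
    · rw [chainCount_eq_sum h, ← Finset.sum_coe_sort]
      refine (Finset.sum_le_sum fun x _ => ih x.1 x.2).trans ?_
      rw [← Nat.card_sigma]
      exact Nat.card_le_card_of_injective _ extend_injective

theorem natCast_add_one_rpow_le {n : ℕ} (hn : 39 ≤ n) :
    ((n + 1 : ℕ) : ℝ) ^ (6.05 : ℝ) * (n : ℝ) ^ 7 ≤ (n : ℝ) ^ (6.05 : ℝ) * (n + 1 : ℝ) ^ 7 := by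
  have h0 : (0 : ℝ) < n := by exact_mod_cast (by omega : 0 < n)
  have h1 : ((n + 1 : ℕ) : ℝ) = n * (1 + 1 / n) := by field_simp; push_cast; ring
  have h2 : ((1 : ℝ) + 1 / n) ^ (6.05 : ℝ) ≤ (1 + 1 / n) ^ 7 := by
    rw [← Real.rpow_natCast]
    exact Real.rpow_le_rpow_of_exponent_le (by simp) (by norm_num)
  rw [h1, Real.mul_rpow h0.le (by positivity)]
  have h3 : (n : ℝ) + 1 = n * (1 + 1 / n) := by field_simp
  rw [h3, mul_pow]
  calc _ = (n : ℝ) ^ (6.05 : ℝ) * n ^ 7 * (1 + 1 / n) ^ (6.05 : ℝ) := by ring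
    _ ≤ (n : ℝ) ^ (6.05 : ℝ) * n ^ 7 * (1 + 1 / n) ^ 7 := by gcongr
    _ = _ := by ring

theorem natCast_add_one_rpow_le_mul {n : ℕ} (hn : 39 ≤ n) :
    ((n + 1 : ℕ) : ℝ) ^ (6.05 : ℝ) ≤ 5 / 4 * (n : ℝ) ^ (6.05 : ℝ) := by
  have h0 : (0 : ℝ) < n := by exact_mod_cast (by omega : 0 < n)
  have h39 : (39 : ℝ) ≤ n := by exact_mod_cast hn
  have h1 : (n + 1 : ℝ) ^ 7 ≤ 5 / 4 * (n : ℝ) ^ 7 := by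
    calc (n + 1 : ℝ) ^ 7 ≤ (40 / 39 * (n : ℝ)) ^ 7 := by gcongr; linarith
      _ = (40 / 39) ^ 7 * (n : ℝ) ^ 7 := by ring
      _ ≤ 5 / 4 * (n : ℝ) ^ 7 := by gcongr; norm_num
  refine le_of_mul_le_mul_right ((natCast_add_one_rpow_le hn).trans ?_)
    (pow_pos h0 7)
  calc _ ≤ (n : ℝ) ^ (6.05 : ℝ) * (5 / 4 * (n : ℝ) ^ 7) := by gcongr
    _ = _ := by ring

theorem thirty_nine_rpow_le : ((39 : ℕ) : ℝ) ^ (6.05 : ℝ) ≤ 2 ^ 32 := by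
  refine le_of_pow_le_pow_left₀ (n := 20) (by norm_num) (by norm_num) ?_
  rw [← Real.rpow_natCast, ← Real.rpow_mul (by norm_num),
    show (6.05 : ℝ) * (20 : ℕ) = (121 : ℕ) by norm_num, Real.rpow_natCast]
  norm_num

theorem ballot_fourteen_succ (m : ℕ) (hm : 14 ≤ m) :
    ballot (m + 1) 14 * ((m + 2) * (m - 13)) = ballot m 14 * ((m + 15) * (m - 12)) := by
  obtain ⟨a, rfl⟩ := Nat.exists_eq_add_of_le hm
  have h1 := ballot_mul_succ (show 14 ≤ 14 + a by omega)
  have h2 := ballot_mul_succ (show 14 ≤ 14 + a + 1 by omega)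
  have h3 := Nat.choose_mul_succ_eq (14 + a + 14) 14
  simp only [show 14 + a + 14 + 1 - 14 = a + 15 by omega,
    show 14 + a + 1 + 1 - 14 = a + 2 by omega, show 14 + a + 1 - 14 = a + 1 by omega,
    show 14 + a - 13 = a + 1 by omega, show 14 + a - 12 = a + 2 by omega,
    show 14 + a + 1 + 14 = 14 + a + 14 + 1 by omega] at h1 h2 h3 ⊢
  apply Nat.eq_of_mul_eq_mul_right (show 0 < a + 15 by omega)
  linear_combination (a + 1) * (a + 15) * h2 - (a + 2) * (a + 29) * h1 - (a + 1) * (a + 2) * h3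

theorem rpow_le_ballot_fourteen {n : ℕ} (hn : 39 ≤ n) :
    5 / 4 * (n : ℝ) ^ (6.05 : ℝ) ≤ ballot (n - 14) 14 := by
  induction n, hn using Nat.le_induction with
  | base =>
    rw [ballot_eq_div (by norm_num)]
    calc _ ≤ 5 / 4 * (2 : ℝ) ^ 32 := by gcongr; exact thirty_nine_rpow_le
      _ ≤ _ := by norm_num [Nat.choose]
  | succ n hn ih =>
    obtain ⟨a, rfl⟩ := Nat.exists_eq_add_of_le hn
    have h := ballot_fourteen_succ (a + 25) (by omega)
    simp only [show 39 + a + 1 - 14 = a + 25 + 1 by omega, show 39 + a - 14 = a + 25 by omega,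
      show a + 25 - 13 = a + 12 by omega, show a + 25 - 12 = a + 13 by omega] at ih h ⊢
    have h' : (ballot (a + 25 + 1) 14 : ℝ) * ((a + 27) * (a + 12)) =
      ballot (a + 25) 14 * ((a + 40) * (a + 13)) := by exact_mod_cast h
    set b : ℝ := ((ballot (a + 25) 14 : ℕ) : ℝ)
    set c : ℝ := ((ballot (a + 25 + 1) 14 : ℕ) : ℝ)
    have h1 := natCast_add_one_rpow_le (n := 39 + a) (by omega)
    push_cast at h1 ih ⊢
    set f := (39 + a : ℝ) ^ (6.05 : ℝ)
    set g := (39 + a + 1 : ℝ) ^ (6.05 : ℝ)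
    have h2 : (39 + a + 1 : ℝ) ^ 7 * ((a + 27) * (a + 12)) ≤
        (39 + a) ^ 7 * ((a + 40) * (a + 13)) := by
      rw [← sub_nonneg]
      ring_nf
      positivity
    have hb : 0 ≤ b := Nat.cast_nonneg _
    refine le_of_mul_le_mul_right ?_
      (show (0 : ℝ) < (39 + a) ^ 7 * ((a + 27) * (a + 12)) by positivity)
    calc 5 / 4 * g * ((39 + a : ℝ) ^ 7 * ((a + 27) * (a + 12)))
        = 5 / 4 * (g * (39 + a : ℝ) ^ 7) * ((a + 27) * (a + 12)) := by ring
      _ ≤ 5 / 4 * (f * (39 + a + 1 : ℝ) ^ 7) * ((a + 27) * (a + 12)) := by gcongr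
      _ = 5 / 4 * f * ((39 + a + 1 : ℝ) ^ 7 * ((a + 27) * (a + 12))) := by ring
      _ ≤ b * ((39 + a : ℝ) ^ 7 * ((a + 40) * (a + 13))) := by gcongr
      _ = c * ((39 + a) ^ 7 * ((a + 27) * (a + 12))) := by linear_combination -(39 + a : ℝ) ^ 7 * h'

theorem five_quarters_mul_two_pow_le_ballot {r : ℕ} (h : 20 ≤ r) (h' : r ≤ 25) :
    5 / 4 * (2 : ℝ) ^ 32 ≤ ballot r (39 - r) := by
  rw [ballot_eq_div (by omega)]
  interval_cases r <;> norm_num [Nat.choose]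

/-- The bounds that are propagated by removing corners. -/
def RpowBound (μ : YoungDiagram) : Prop :=
  (μ.card : ℝ) ^ (6.05 : ℝ) ≤ μ.chainCount ∧
    (2 ≤ μ.corners.card → 5 / 4 * (μ.card : ℝ) ^ (6.05 : ℝ) ≤ μ.chainCount)

theorem rpowBound_of_le (h : 5 / 4 * (μ.card : ℝ) ^ (6.05 : ℝ) ≤ μ.chainCount) :
    μ.RpowBound := by
  refine ⟨le_trans ?_ h, fun _ => h⟩
  have : 0 ≤ (μ.card : ℝ) ^ (6.05 : ℝ) := by positivity
  linarith

theorem RpowBound.transpose (h : μ.transpose.RpowBound) : μ.RpowBound := by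
  unfold RpowBound at *
  rwa [card_transpose, chainCount_transpose, card_corners_transpose] at h

theorem rpowBound_of_rowLen_add_fourteen (h : 39 ≤ μ.card) (hr : μ.rowLen 0 + 14 = μ.card) :
    μ.RpowBound := by
  apply rpowBound_of_le
  refine (rpow_le_ballot_fourteen h).trans ?_
  exact_mod_cast ballot_le_chainCount (by omega) (by omega) (by omega)

theorem rpowBound_of_twenty_le_rowLen (h : μ.card = 39) (hr : 20 ≤ μ.rowLen 0)
    (hr' : μ.rowLen 0 + 14 ≤ μ.card) : μ.RpowBound := by
  apply rpowBound_of_le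
  rw [h]
  calc _ ≤ 5 / 4 * (2 : ℝ) ^ 32 := by gcongr; exact thirty_nine_rpow_le
    _ ≤ ballot (μ.rowLen 0) (39 - μ.rowLen 0) :=
      five_quarters_mul_two_pow_le_ballot hr (by omega)
    _ ≤ _ := by exact_mod_cast ballot_le_chainCount rfl (by omega) (by omega)

theorem rpowBound_of_card_eq (h : μ.card = 39) (hr : μ.rowLen 0 + 14 ≤ μ.card)
    (hc : μ.colLen 0 + 14 ≤ μ.card) : μ.RpowBound := by
  by_cases hr' : 20 ≤ μ.rowLen 0
  · exact rpowBound_of_twenty_le_rowLen h hr' hr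
  by_cases hc' : 20 ≤ μ.colLen 0
  · refine RpowBound.transpose (rpowBound_of_twenty_le_rowLen ?_ ?_ ?_) <;>
      simpa only [card_transpose, rowLen_transpose]
  have hrc := card_le_rowLen_mul_colLen (μ := μ)
  have h1 : 3 ≤ μ.rowLen 0 := by by_contra! h1; nlinarith
  have h2 : 3 ≤ μ.colLen 0 := by by_contra! h2; nlinarith
  have h3 := card_corners_mul_two_pow_le μ h.le h1 h2 (by omega) (by omega)
  have h4 : 0 < μ.corners.card := Finset.card_pos.2 (corners_nonempty (by omega))
  have h5 : (μ.corners.card : ℝ) * 2 ^ 32 ≤ μ.chainCount := by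
    have : (μ.corners.card : ℝ) * 2 ^ μ.card ≤ 128 * μ.chainCount := by exact_mod_cast h3
    rw [h] at this
    linarith
  have h6 := thirty_nine_rpow_le
  rw [RpowBound, h]
  refine ⟨?_, fun ht => ?_⟩
  · have : (1 : ℝ) ≤ μ.corners.card := by exact_mod_cast h4
    linarith
  · have : (2 : ℝ) ≤ μ.corners.card := by exact_mod_cast ht
    linarith

theorem rpowBound_of_remove (h : 40 ≤ μ.card) (hr : μ.rowLen 0 + 14 ≤ μ.card)
    (hc : μ.colLen 0 + 14 ≤ μ.card) (ih : ∀ x ∈ μ.corners, (μ.remove x).RpowBound) :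
    μ.RpowBound := by
  obtain ⟨n, hn⟩ := Nat.exists_eq_add_of_le' (show 1 ≤ μ.card by omega)
  have hcard {x} (hx : x ∈ μ.corners) : (μ.remove x).card = n := by
    have := card_remove_add_one hx
    omega
  have hsum := chainCount_eq_sum (μ := μ) (by omega)
  have h1 := natCast_add_one_rpow_le_mul (n := n) (by omega)
  have h0 : 0 ≤ (n : ℝ) ^ (6.05 : ℝ) := by positivity
  have hrc := card_le_rowLen_mul_colLen (μ := μ)
  have h4 : 0 < μ.corners.card := Finset.card_pos.2 (corners_nonempty (by omega))
  have h2 : 2 ≤ μ.corners.card → 5 / 4 * (μ.card : ℝ) ^ (6.05 : ℝ) ≤ μ.chainCount := by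
    intro ht
    have h3 : (μ.corners.card : ℝ) * (n : ℝ) ^ (6.05 : ℝ) ≤ μ.chainCount := by
      rw [hsum, Nat.cast_sum, ← nsmul_eq_mul]
      exact Finset.card_nsmul_le_sum _ _ _ fun x hx => hcard hx ▸ (ih x hx).1
    have ht' : (2 : ℝ) ≤ μ.corners.card := by exact_mod_cast ht
    rw [hn]
    nlinarith
  by_cases ht : 2 ≤ μ.corners.card
  · exact rpowBound_of_le (h2 ht)
  refine ⟨?_, h2⟩
  obtain ⟨x, hx⟩ := Finset.card_eq_one.1 (show μ.corners.card = 1 by omega)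
  have hxm : x ∈ μ.corners := hx ▸ Finset.mem_singleton_self x
  have h5 := (ih x hxm).2
    (two_le_card_corners_remove hx (by by_contra! h1; nlinarith) (by by_contra! h1; nlinarith))
  rw [hcard hxm] at h5
  rw [hn]
  refine (h1.trans h5).trans ?_
  exact_mod_cast chainCount_remove_le hxm

theorem rpowBound (μ : YoungDiagram) (h : 39 ≤ μ.card) (hr : μ.rowLen 0 + 14 ≤ μ.card)
    (hc : μ.colLen 0 + 14 ≤ μ.card) : μ.RpowBound := by
  induction μ using card_induction with
  | step μ ih =>
    obtain h | h := h.eq_or_lt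
    · exact rpowBound_of_card_eq h.symm hr hc
    by_cases hr' : μ.rowLen 0 + 14 = μ.card
    · exact rpowBound_of_rowLen_add_fourteen h.le hr'
    by_cases hc' : μ.colLen 0 + 14 = μ.card
    · apply RpowBound.transpose
      apply rpowBound_of_rowLen_add_fourteen
      · rw [card_transpose]; exact h.le
      · rwa [card_transpose, rowLen_transpose]
    refine rpowBound_of_remove h hr hc fun x hx => ?_
    have h1 := card_remove_add_one hx
    have h2 := (rowLen_remove_le hx 0).1
    have h3 := (colLen_remove_le hx 0).1
    exact ih x hx (by omega) (by omega) (by omega)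

end YoungDiagram

/-- **Lemma (dimension ≥ n^6.05).** Let `n ≥ 39` and let `μ ⊢ n` be a Young diagram with
at least 14 boxes outside its first row and at least 14 boxes outside its first column. Then
the number of standard Young tableaux of shape `μ` (i.e. the dimension of the corresponding
irreducible representation of `S_n`) is at least `n^6.05`. -/
theorem dim_ge_n_pow_six_point_o_five (n : ℕ) (hn : 39 ≤ n) (μ : YoungDiagram)
    (hcard : μ.card = n) (hrow : 14 ≤ n - μ.rowLen 0) (hcol : 14 ≤ n - μ.colLen 0) :
    (n : ℝ) ^ (6.05 : ℝ) ≤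
      (Nat.card {T : {x // x ∈ μ.cells} ≃ Fin μ.card // IsStandardYT μ T} : ℝ) := by
  subst hcard
  have h := (YoungDiagram.rpowBound μ hn (by omega) (by omega)).1
  refine h.trans ?_
  exact_mod_cast YoungDiagram.chainCount_le_card_isStandardYT μ
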